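/- arXiv:math/0605297 — 2 statements merged into one kernel-verified Lean document; each statement's English description precedes it below -/
import Mathlib

section
/- Define ψ_0(t) = 1 and ψ_n(t) = n!·(φ_n(t) − I_n) for n ≥ 1. Then for every n ≥ 0 the polynomial ψ_n(t) equals the n-th Bernoulli polynomial B_n(t). -/
open Polynomial

/-- The formal antiderivative of a polynomial (with zero constant term):
`∫₀ᵗ p`, sending `a·tⁿ` to `a/(n+1)·tⁿ⁺¹`. -/
noncomputable def integralPoly (p : ℚ[X]) : ℚ[X] :=
  p.sum fun n a => Polynomial.C (a / ((n : ℚ) + 1)) * Polynomial.X ^ (n + 1)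

/-- The polynomials `φ_n ∈ ℚ[t]`, defined recursively by `φ₁(t) = t`,
`φ_{n+1}(t) = ∫₀ᵗ φ_n(s) ds − t·I_n`, where `I_n = ∫₀¹ φ_n(t) dt`
(the formal antiderivative evaluated at the endpoints). -/
noncomputable def phiP : ℕ → ℚ[X]
  | 0 => 0
  | 1 => Polynomial.X
  | n + 2 =>
    integralPoly (phiP (n + 1)) -
      Polynomial.C ((integralPoly (phiP (n + 1))).eval 1 -
        (integralPoly (phiP (n + 1))).eval 0) * Polynomial.X

/-- `I_n = ∫₀¹ φ_n(t) dt`, the formal antiderivative evaluated at the endpoints. -/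
noncomputable def Ival (n : ℕ) : ℚ :=
  (integralPoly (phiP n)).eval 1 - (integralPoly (phiP n)).eval 0

/-- `ψ₀(t) = 1` and `ψ_n(t) = n!·(φ_n(t) − I_n)` for `n ≥ 1`. -/
noncomputable def psiP : ℕ → ℚ[X]
  | 0 => 1
  | n + 1 =>
    Polynomial.C (((n + 1).factorial : ℚ)) * (phiP (n + 1) - Polynomial.C (Ival (n + 1)))

theorem coeff_integralPoly_zero (p : ℚ[X]) : (integralPoly p).coeff 0 = 0 := by
  simp [integralPoly, Polynomial.sum, Polynomial.coeff_X_pow]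

theorem coeff_integralPoly_succ (p : ℚ[X]) (k : ℕ) :
    (integralPoly p).coeff (k + 1) = p.coeff k / ((k : ℚ) + 1) := by
  simp only [integralPoly, Polynomial.sum, Polynomial.finsetSum_coeff, Polynomial.coeff_C_mul,
    Polynomial.coeff_X_pow, add_left_inj, mul_ite, mul_one, mul_zero, Finset.sum_ite_eq]
  split_ifs with h
  · rfl
  · simp [Polynomial.notMem_support_iff.mp h]

theorem integralPoly_eq (p q : ℚ[X]) (hd : derivative q = p) (h0 : q.eval 0 = 0) :
    integralPoly p = q := by
  ext k
  cases k with
  | zero => rw [coeff_integralPoly_zero, Polynomial.coeff_zero_eq_eval_zero, h0]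
  | succ k =>
    rw [coeff_integralPoly_succ, ← hd, Polynomial.coeff_derivative]
    have : (k : ℚ) + 1 ≠ 0 := by positivity
    field_simp

theorem integral_step (n : ℕ)
    (h : phiP (n + 1) = C (1 / ((n + 1).factorial : ℚ)) *
      (Polynomial.bernoulli (n + 1) - C (_root_.bernoulli (n + 1)))) :
    integralPoly (phiP (n + 1)) = C (1 / ((n + 2).factorial : ℚ)) *
      (Polynomial.bernoulli (n + 2) - C (_root_.bernoulli (n + 2)))
      - C (_root_.bernoulli (n + 1) / ((n + 1).factorial : ℚ)) * X := by
  apply integralPoly_eq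
  · have hf : ((n + 1).factorial : ℚ) ≠ 0 := by positivity
    have h2 : (n : ℚ) + 2 ≠ 0 := by positivity
    have e : (1 / ((n + 2).factorial : ℚ)) * ((n : ℚ) + 2) = 1 / ((n + 1).factorial : ℚ) := by
      rw [Nat.factorial_succ (n + 1)]
      push_cast
      field_simp
      ring
    have e2 : ((((n + 1 : ℕ) : ℚ[X])) + 1) = C ((n : ℚ) + 2) := by
      simp only [map_add, map_natCast, map_ofNat]
      push_cast
      ring
    rw [h, derivative_sub, derivative_C_mul, derivative_sub, derivative_C,
      Polynomial.derivative_bernoulli_add_one (n + 1), derivative_C_mul, derivative_X, e2,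
      sub_zero, ← mul_assoc, ← C_mul, e, mul_sub, ← C_mul, mul_one]
    congr 2
    ring
  · simp [Polynomial.bernoulli_eval_zero]

theorem Ival_step (n : ℕ)
    (h : phiP (n + 1) = C (1 / ((n + 1).factorial : ℚ)) *
      (Polynomial.bernoulli (n + 1) - C (_root_.bernoulli (n + 1)))) :
    Ival (n + 1) = - (_root_.bernoulli (n + 1) / ((n + 1).factorial : ℚ)) := by
  rw [Ival, integral_step n h]
  have : bernoulli' (n + 2) = _root_.bernoulli (n + 2) :=
    (bernoulli_eq_bernoulli'_of_ne_one (by omega)).symm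
  simp [Polynomial.bernoulli_eval_zero, Polynomial.bernoulli_eval_one, this]

theorem phiP_eq (n : ℕ) : phiP (n + 1) = C (1 / ((n + 1).factorial : ℚ)) *
      (Polynomial.bernoulli (n + 1) - C (_root_.bernoulli (n + 1))) := by
  induction n with
  | zero =>
    rw [phiP, Polynomial.bernoulli_one, _root_.bernoulli_one]
    have : (C (-1 / 2 : ℚ)) = - C (2⁻¹ : ℚ) := by rw [← C_neg]; norm_num
    simp [this]
  | succ n ih =>
    have hI := Ival_step n ih
    rw [Ival] at hI
    rw [phiP, hI, integral_step n ih, C_neg]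
    ring

/-- For every `n ≥ 0` the polynomial `ψ_n(t)` equals the `n`-th Bernoulli polynomial
`B_n(t)` (defined by `x·e^{tx}/(eˣ−1) = Σ B_n(t)·xⁿ/n!`). -/
theorem psiP_eq_bernoulli (n : ℕ) : psiP n = Polynomial.bernoulli n := by
  cases n with
  | zero => rw [psiP, Polynomial.bernoulli_zero]
  | succ n =>
    have hf : ((n + 1).factorial : ℚ) ≠ 0 := by positivity
    rw [psiP, Ival_step n (phiP_eq n), phiP_eq n, mul_sub, mul_sub, mul_sub, ← mul_assoc, ← C_mul,
      ← C_mul, mul_one_div_cancel hf, ← C_mul, ← C_mul, mul_neg, mul_div_cancel₀ _ hf,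
      ← mul_assoc, mul_one_div_cancel hf]
    simp
end

section
/- Let U ⊆ V ⊆ W be subcomplexes of a cochain complex W of vector spaces over a field K, and set L_{U,V,W} = L_{U,W} ∩ L_{V,W}, the subcomplex of Hom*(W, W) of maps preserving both U and V. If the inclusion U → V is a quasi-isomorphism, then the two inclusions L_{U,V,W} → L_{V,W} and L_{U,V,W} → L_{U,W} are quasi-isomorphisms. -/
universe u

/-- A cochain complex of `K`-vector spaces, given by its components and its
degree-one differential.  (The condition `d ∘ d = 0` is `Cx.IsComplex`.) -/
structure Cx (K : Type u) [Field K] where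
  V : ℤ → Type u
  [acg : ∀ i, AddCommGroup (V i)]
  [mod : ∀ i, Module K (V i)]
  d : ∀ i, V i →ₗ[K] V (i + 1)

attribute [instance] Cx.acg Cx.mod

/-- Transport along an equality of degrees. -/
def castL (K : Type u) [Field K] (V : ℤ → Type u) [∀ i, AddCommGroup (V i)] [∀ i, Module K (V i)] {i j : ℤ}
    (h : i = j) : V i →ₗ[K] V j where
  toFun x := h ▸ x
  map_add' := by subst h; intros; rfl
  map_smul' := by subst h; intros; rfl

variable {K : Type u} [Field K]

/-- The differential squares to zero. -/
def Cx.IsComplex (A : Cx K) : Prop := ∀ (i : ℤ) (x : A.V i), A.d (i + 1) (A.d i x) = 0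

/-- A family of linear maps is a morphism of complexes if it commutes with the
differentials. -/
def IsChainMap (A B : Cx K) (f : ∀ i, A.V i →ₗ[K] B.V i) : Prop :=
  ∀ (i : ℤ) (x : A.V i), f (i + 1) (A.d i x) = B.d i (f i x)

/-- A morphism of complexes is a quasi-isomorphism if it induces an isomorphism on
cohomology in every degree: a cocycle of `A` whose image is a coboundary is a
coboundary, and every cocycle of `B` is, modulo coboundaries, the image of a
cocycle of `A`. -/
def IsQuasiIso (A B : Cx K) (f : ∀ i, A.V i →ₗ[K] B.V i) : Prop :=
  ∀ n : ℤ,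
    (∀ x : A.V (n + 1), A.d (n + 1) x = 0 → (∃ w, B.d n w = f (n + 1) x) →
      ∃ v, A.d n v = x) ∧
    (∀ y : B.V (n + 1), B.d (n + 1) y = 0 →
      ∃ x : A.V (n + 1), A.d (n + 1) x = 0 ∧ ∃ w, B.d n w = y - f (n + 1) x)

/-- A complex is acyclic if all its cohomology vanishes. -/
def Cx.Acyclic (A : Cx K) : Prop :=
  ∀ (n : ℤ) (x : A.V (n + 1)), A.d (n + 1) x = 0 → ∃ y, A.d n y = x


/-- The degree-`n` component `Hom^n(A, B) = Π_j Hom(A^j, B^{j+n})` of the Hom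
complex. -/
abbrev homV (A B : Cx K) (n : ℤ) : Type u := ∀ j : ℤ, A.V j →ₗ[K] B.V (j + n)

/-- The differential `δ(f) = d_B ∘ f − (−1)ⁿ f ∘ d_A` of the Hom complex. -/
def homD (A B : Cx K) (n : ℤ) : homV A B n →ₗ[K] homV A B (n + 1) where
  toFun f := fun j =>
    castL K B.V (show j + n + 1 = j + (n + 1) by omega) ∘ₗ B.d (j + n) ∘ₗ f j -
      ((-1 : K) ^ n) • (castL K B.V (show j + 1 + n = j + (n + 1) by omega) ∘ₗ
        f (j + 1) ∘ₗ A.d j)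
  map_add' f g := by
    funext j; ext x
    simp [smul_add]
    abel
  map_smul' c f := by
    funext j; ext x
    simp [smul_comm c, smul_sub]

/-- The Hom complex `Hom*(A, B)`. -/
def homCx (A B : Cx K) : Cx K where
  V n := homV A B n
  d n := homD A B n

/-- The subcomplex determined by a family of submodules preserved by the
differential. -/
def subCx (W : Cx K) (S : ∀ i, Submodule K (W.V i))
    (hS : ∀ i, ∀ x ∈ S i, W.d i x ∈ S (i + 1)) : Cx K where
  V i := ↥(S i)
  d i := (W.d i).restrict (hS i)

/-- The submodule `L_{V,W}^n ⊆ Hom^n(W, W)` of homogeneous maps preserving the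
subcomplex `S`. -/
def presSub (W : Cx K) (S : ∀ i, Submodule K (W.V i)) (n : ℤ) :
    Submodule K (homV W W n) where
  carrier := { f | ∀ j, ∀ x ∈ S j, f j x ∈ S (j + n) }
  add_mem' hf hg j x hx := by
    simpa using Submodule.add_mem _ (hf j x hx) (hg j x hx)
  zero_mem' j x hx := by simp
  smul_mem' c f hf j x hx := by
    simpa using Submodule.smul_mem _ c (hf j x hx)

lemma mem_presSub {W : Cx K} {S : ∀ i, Submodule K (W.V i)} {n : ℤ} {f : homV W W n} :
    f ∈ presSub W S n ↔ ∀ j, ∀ x ∈ S j, f j x ∈ S (j + n) := Iff.rfl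

lemma castL_mem {V : ℤ → Type u} [∀ i, AddCommGroup (V i)] [∀ i, Module K (V i)]
    (S : ∀ i, Submodule K (V i)) {i j : ℤ} (h : i = j) {x : V i} (hx : x ∈ S i) :
    castL K V h x ∈ S j := by subst h; exact hx

lemma homD_pres (W : Cx K) (S : ∀ i, Submodule K (W.V i))
    (hS : ∀ i, ∀ x ∈ S i, W.d i x ∈ S (i + 1)) (n : ℤ) :
    ∀ f ∈ presSub W S n, homD W W n f ∈ presSub W S (n + 1) := by
  intro f hf j x hx
  show (homD W W n f) j x ∈ _
  simp only [homD, LinearMap.coe_mk, AddHom.coe_mk, Pi.sub_apply, Pi.smul_apply,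
    LinearMap.sub_apply, LinearMap.smul_apply, LinearMap.comp_apply]
  exact Submodule.sub_mem _ (castL_mem S _ (hS _ _ (hf j x hx)))
    (Submodule.smul_mem _ _ (castL_mem S _ (hf (j + 1) _ (hS j x hx))))

/-- The subcomplex `L_{V,W} ⊆ Hom*(W, W)` of maps preserving `S`, as a complex. -/
def presCx (W : Cx K) (S : ∀ i, Submodule K (W.V i))
    (hS : ∀ i, ∀ x ∈ S i, W.d i x ∈ S (i + 1)) : Cx K where
  V n := ↥(presSub W S n)
  d n := (homD W W n).restrict (homD_pres W S hS n)

lemma homD_pres2 (W : Cx K) (S T : ∀ i, Submodule K (W.V i))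
    (hS : ∀ i, ∀ x ∈ S i, W.d i x ∈ S (i + 1))
    (hT : ∀ i, ∀ x ∈ T i, W.d i x ∈ T (i + 1)) (n : ℤ) :
    ∀ f ∈ presSub W S n ⊓ presSub W T n,
      homD W W n f ∈ presSub W S (n + 1) ⊓ presSub W T (n + 1) := by
  intro f hf
  rcases Submodule.mem_inf.mp hf with ⟨h1, h2⟩
  exact Submodule.mem_inf.mpr ⟨homD_pres W S hS n f h1, homD_pres W T hT n f h2⟩

/-- The subcomplex `L_{U,V,W} = L_{U,W} ∩ L_{V,W} ⊆ Hom*(W, W)` of maps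
preserving both subcomplexes, as a complex. -/
def presCx2 (W : Cx K) (S T : ∀ i, Submodule K (W.V i))
    (hS : ∀ i, ∀ x ∈ S i, W.d i x ∈ S (i + 1))
    (hT : ∀ i, ∀ x ∈ T i, W.d i x ∈ T (i + 1)) : Cx K where
  V n := ↥(presSub W S n ⊓ presSub W T n)
  d n := (homD W W n).restrict (homD_pres2 W S T hS hT n)


@[simp] lemma castL_rfl' {V : ℤ → Type u} [∀ i, AddCommGroup (V i)] [∀ i, Module K (V i)]
    {i : ℤ} (h : i = i) (x : V i) : castL K V h x = x := rfl

/-- flexible differential -/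
def DD (W : Cx K) {i j : ℤ} (e : i + 1 = j) : W.V i →ₗ[K] W.V j := castL K W.V e ∘ₗ W.d i

/-- flexible component -/
def FF {W : Cx K} {n : ℤ} (f : homV W W n) {i k : ℤ} (e : i + n = k) : W.V i →ₗ[K] W.V k :=
  castL K W.V e ∘ₗ f i

/-- flexible homotopy -/
def HH {W : Cx K} (h : ∀ i, W.V (i + 1) →ₗ[K] W.V i) {i j : ℤ} (e : j = i + 1) :
    W.V j →ₗ[K] W.V i := h i ∘ₗ castL K W.V e

lemma DD_DD (W : Cx K) (hW : W.IsComplex) {i j k : ℤ} (e : i + 1 = j) (e' : j + 1 = k)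
    (x : W.V i) : DD W e' (DD W e x) = 0 := by
  subst e; subst e'; exact hW i x

lemma FF_homD {W : Cx K} {n : ℤ} (f : homV W W n) {i j k l : ℤ} (e : i + (n + 1) = l)
    (e1 : i + n = k) (e2 : k + 1 = l) (e3 : i + 1 = j) (e4 : j + n = l) (x : W.V i) :
    FF (homD W W n f) e x = DD W e2 (FF f e1 x) - ((-1 : K) ^ n) • FF f e4 (DD W e3 x) := by
  subst e; subst e1; subst e3; rfl

lemma homV_ext {W : Cx K} {n : ℤ} {f g : homV W W n}
    (h : ∀ i x, FF f (rfl : i + n = i + n) x = FF g rfl x) : f = g := by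
  funext i; ext x; exact h i x

/-- the map `1 - dh - hd` -/
def PP (W : Cx K) (h : ∀ i, W.V (i + 1) →ₗ[K] W.V i) (j : ℤ) : W.V j →ₗ[K] W.V j :=
  LinearMap.id - DD W (show j - 1 + 1 = j by omega) ∘ₗ HH h (show j = j - 1 + 1 by omega)
    - HH h (rfl : j + 1 = j + 1) ∘ₗ DD W rfl

lemma PP_apply (W : Cx K) (h : ∀ i, W.V (i + 1) →ₗ[K] W.V i) {i j k : ℤ}
    (e1 : i + 1 = j) (e2 : j + 1 = k) (x : W.V j) :
    PP W h j x = x - DD W e1 (HH h e1.symm x) - HH h e2.symm (DD W e2 x) := by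
  obtain rfl : i = j - 1 := by omega
  subst e2; rfl

lemma PP_DD (W : Cx K) (hW : W.IsComplex) (h : ∀ i, W.V (i + 1) →ₗ[K] W.V i) {i j : ℤ}
    (e : i + 1 = j) (x : W.V i) : PP W h j (DD W e x) = DD W e (PP W h i x) := by
  rw [PP_apply W h e rfl, PP_apply W h (show i - 1 + 1 = i by omega) e]
  simp [DD_DD W hW]

/-- left composition with the homotopy -/
def lH {W : Cx K} (h : ∀ i, W.V (i + 1) →ₗ[K] W.V i) {n : ℤ} (y : homV W W (n + 1)) :
    homV W W n := fun j => HH h (show j + (n + 1) = j + n + 1 by omega) ∘ₗ y j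

/-- right composition with the homotopy -/
def rH {W : Cx K} (h : ∀ i, W.V (i + 1) →ₗ[K] W.V i) {n : ℤ} (y : homV W W (n + 1)) :
    homV W W n := fun j => FF y (show j - 1 + (n + 1) = j + n by omega) ∘ₗ
      HH h (show j = j - 1 + 1 by omega)

/-- left composition with degree zero maps -/
def lP {W : Cx K} (p : ∀ i, W.V i →ₗ[K] W.V i) {n : ℤ} (y : homV W W n) :
    homV W W n := fun j => p _ ∘ₗ y j

/-- right composition with degree zero maps -/
def rP {W : Cx K} (p : ∀ i, W.V i →ₗ[K] W.V i) {n : ℤ} (y : homV W W n) :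
    homV W W n := fun j => y j ∘ₗ p j

lemma FF_lH {W : Cx K} (h : ∀ i, W.V (i + 1) →ₗ[K] W.V i) {n : ℤ} (y : homV W W (n + 1))
    {i k l : ℤ} (e : i + n = k) (e1 : i + (n + 1) = l) (e2 : l = k + 1) (x : W.V i) :
    FF (lH h y) e x = HH h e2 (FF y e1 x) := by
  subst e; subst e1; rfl

lemma FF_rH {W : Cx K} (h : ∀ i, W.V (i + 1) →ₗ[K] W.V i) {n : ℤ} (y : homV W W (n + 1))
    {i k l : ℤ} (e : i + n = k) (e1 : i = l + 1) (e2 : l + (n + 1) = k) (x : W.V i) :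
    FF (rH h y) e x = FF y e2 (HH h e1 x) := by
  obtain rfl : l = i - 1 := by omega
  subst e; rfl

lemma FF_lP {W : Cx K} (p : ∀ i, W.V i →ₗ[K] W.V i) {n : ℤ} (y : homV W W n)
    {i k : ℤ} (e : i + n = k) (x : W.V i) :
    FF (lP p y) e x = p k (FF y e x) := by
  subst e; rfl

lemma FF_rP {W : Cx K} (p : ∀ i, W.V i →ₗ[K] W.V i) {n : ℤ} (y : homV W W n)
    {i k : ℤ} (e : i + n = k) (x : W.V i) :
    FF (rP p y) e x = FF y e (p i x) := by
  subst e; rfl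

lemma FF_sub {W : Cx K} {n : ℤ} (f g : homV W W n) {i k : ℤ} (e : i + n = k) (x : W.V i) :
    FF (f - g) e x = FF f e x - FF g e x := by
  subst e; rfl

lemma FF_smul {W : Cx K} {n : ℤ} (c : K) (f : homV W W n) {i k : ℤ} (e : i + n = k)
    (x : W.V i) : FF (c • f) e x = c • FF f e x := by
  subst e; rfl

lemma FF_zero {W : Cx K} {n : ℤ} {i k : ℤ} (e : i + n = k) (x : W.V i) :
    FF (0 : homV W W n) e x = 0 := by
  subst e; rfl

lemma sgn_sq (n : ℤ) : ((-1 : K) ^ n) * (-1 : K) ^ n = 1 := by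
  rw [← mul_zpow]; simp

lemma sgn_succ (n : ℤ) : ((-1 : K) ^ (n + 1)) = - (-1 : K) ^ n := by
  rw [zpow_add₀ (by simp)]; simp

lemma cocycle_comm {W : Cx K} {n : ℤ} {y : homV W W n} (hy : homD W W n y = 0)
    {i j k l : ℤ} (e1 : i + n = k) (e2 : k + 1 = l) (e3 : i + 1 = j) (e4 : j + n = l)
    (x : W.V i) : DD W e2 (FF y e1 x) = ((-1 : K) ^ n) • FF y e4 (DD W e3 x) := by
  have := FF_homD y (show i + (n + 1) = l by omega) e1 e2 e3 e4 x
  rw [hy, FF_zero] at this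
  exact (sub_eq_zero.mp this.symm)

lemma homD_lP {W : Cx K} (hW : W.IsComplex) (h : ∀ i, W.V (i + 1) →ₗ[K] W.V i) {n : ℤ}
    (y : homV W W n) : homD W W n (lP (PP W h) y) = lP (PP W h) (homD W W n y) := by
  apply homV_ext
  intro i x
  rw [FF_lP, FF_homD _ _ rfl (show i + n + 1 = _ by omega) rfl (show i + 1 + n = _ by omega),
    FF_homD _ _ rfl (show i + n + 1 = _ by omega) rfl (show i + 1 + n = _ by omega),
    FF_lP, FF_lP, map_sub, map_smul, PP_DD W hW]

lemma homD_rP {W : Cx K} (hW : W.IsComplex) (h : ∀ i, W.V (i + 1) →ₗ[K] W.V i) {n : ℤ}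
    (y : homV W W n) : homD W W n (rP (PP W h) y) = rP (PP W h) (homD W W n y) := by
  apply homV_ext
  intro i x
  rw [FF_rP, FF_homD _ _ rfl (show i + n + 1 = _ by omega) rfl (show i + 1 + n = _ by omega),
    FF_homD _ _ rfl (show i + n + 1 = _ by omega) rfl (show i + 1 + n = _ by omega),
    FF_rP, FF_rP, PP_DD W hW]

lemma homD_lH {W : Cx K} (h : ∀ i, W.V (i + 1) →ₗ[K] W.V i) {n : ℤ}
    (y : homV W W (n + 1)) (hy : homD W W (n + 1) y = 0) :
    homD W W n (lH h y) = y - lP (PP W h) y := by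
  apply homV_ext
  intro i x
  have e1 : i + n + 1 = i + (n + 1) := by omega
  have e2 : i + 1 + n = i + (n + 1) := by omega
  have e3 : i + 1 + (n + 1) = i + (n + 1) + 1 := by omega
  rw [FF_homD _ _ rfl e1 rfl e2, FF_sub, FF_lP, FF_lH h y rfl rfl e1.symm,
    FF_lH h y e2 e3 rfl, PP_apply W h e1 rfl, cocycle_comm hy rfl rfl rfl e3, map_smul,
    sgn_succ]
  module

lemma homD_rH {W : Cx K} (h : ∀ i, W.V (i + 1) →ₗ[K] W.V i) {n : ℤ}
    (y : homV W W (n + 1)) (hy : homD W W (n + 1) y = 0) :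
    homD W W n (((-1 : K) ^ (n + 1)) • rH h y) = y - rP (PP W h) y := by
  apply homV_ext
  intro i x
  have e1 : i + n + 1 = i + (n + 1) := by omega
  have e2 : i + 1 + n = i + (n + 1) := by omega
  have e3 : i - 1 + 1 = i := by omega
  have e4 : i - 1 + (n + 1) = i + n := by omega
  rw [map_smul, FF_smul, FF_homD _ _ rfl e1 rfl e2, FF_sub, FF_rP, FF_rH h y rfl e3.symm e4,
    FF_rH h y e2 rfl rfl, PP_apply W h e3 rfl, cocycle_comm hy e4 e1 e3 rfl, map_sub, map_sub,
    smul_sub, smul_smul, smul_smul, sgn_sq, sgn_succ, neg_mul, sgn_sq]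
  module

lemma mem_pres_FF {W : Cx K} {S : ∀ i, Submodule K (W.V i)} {n : ℤ} {f : homV W W n}
    (hf : f ∈ presSub W S n) {i k : ℤ} (e : i + n = k) {x : W.V i} (hx : x ∈ S i) :
    FF f e x ∈ S k := castL_mem S e (hf i x hx)

lemma DD_mem {W : Cx K} {S : ∀ i, Submodule K (W.V i)}
    (hS : ∀ i, ∀ x ∈ S i, W.d i x ∈ S (i + 1)) {i k : ℤ} (e : i + 1 = k) {x : W.V i}
    (hx : x ∈ S i) : DD W e x ∈ S k := castL_mem S e (hS i x hx)

lemma HH_mem {W : Cx K} {S : ∀ i, Submodule K (W.V i)} {h : ∀ i, W.V (i + 1) →ₗ[K] W.V i}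
    (hh : ∀ i, ∀ x ∈ S (i + 1), h i x ∈ S i) {i k : ℤ} (e : k = i + 1) {x : W.V k}
    (hx : x ∈ S k) : HH h e x ∈ S i := hh i _ (castL_mem S e hx)

lemma PP_mem {W : Cx K} {S : ∀ i, Submodule K (W.V i)}
    (hS : ∀ i, ∀ x ∈ S i, W.d i x ∈ S (i + 1)) {h : ∀ i, W.V (i + 1) →ₗ[K] W.V i}
    (hh : ∀ i, ∀ x ∈ S (i + 1), h i x ∈ S i) {i : ℤ} {x : W.V i}
    (hx : x ∈ S i) : PP W h i x ∈ S i := by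
  rw [PP_apply W h (show i - 1 + 1 = i by omega) rfl]
  exact sub_mem (sub_mem hx (DD_mem hS _ (HH_mem hh _ hx))) (HH_mem hh _ (DD_mem hS _ hx))

lemma lH_mem {W : Cx K} {S : ∀ i, Submodule K (W.V i)} {h : ∀ i, W.V (i + 1) →ₗ[K] W.V i}
    (hh : ∀ i, ∀ x ∈ S (i + 1), h i x ∈ S i) {n : ℤ} {y : homV W W (n + 1)}
    (hy : y ∈ presSub W S (n + 1)) : lH h y ∈ presSub W S n :=
  fun j x hx => HH_mem hh _ (hy j x hx)

lemma rH_mem {W : Cx K} {S : ∀ i, Submodule K (W.V i)} {h : ∀ i, W.V (i + 1) →ₗ[K] W.V i}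
    (hh : ∀ i, ∀ x ∈ S (i + 1), h i x ∈ S i) {n : ℤ} {y : homV W W (n + 1)}
    (hy : y ∈ presSub W S (n + 1)) : rH h y ∈ presSub W S n :=
  fun j x hx => mem_pres_FF hy _ (HH_mem hh _ hx)

lemma exists_g (W : Cx K) (hW : W.IsComplex)
    (SU SV : ∀ i, Submodule K (W.V i))
    (hU : ∀ i, ∀ x ∈ SU i, W.d i x ∈ SU (i + 1))
    (hV : ∀ i, ∀ x ∈ SV i, W.d i x ∈ SV (i + 1))
    (hUV : ∀ i, SU i ≤ SV i)
    (hq : IsQuasiIso (subCx W SU hU) (subCx W SV hV)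
      (fun i => Submodule.inclusion (hUV i))) (i : ℤ) :
    ∃ g : W.V (i + 1) →ₗ[K] W.V i, (∀ x, g x ∈ SV i) ∧ (∀ x ∈ SU (i + 1), g x = 0) ∧
      ∀ x ∈ SV (i + 1), W.d (i + 1) x ∈ SU (i + 1 + 1) → x - W.d i (g x) ∈ SU (i + 1) := by
  have hac : ∀ x ∈ SV (i + 1), W.d (i + 1) x ∈ SU (i + 1 + 1) →
      ∃ v ∈ SV i, ∃ w ∈ SU (i + 1), W.d i v + w = x := by
    intro x hx hdx
    obtain ⟨u, hu⟩ := (hq (i + 1)).1 (⟨W.d (i + 1) x, hdx⟩ : SU (i + 1 + 1))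
      (Subtype.ext (hW _ _)) ⟨(⟨x, hx⟩ : SV (i + 1)), rfl⟩
    have hu' : W.d (i + 1) (u : SU (i + 1)).1 = W.d (i + 1) x := congrArg Subtype.val hu
    obtain ⟨z, -, w, hw⟩ := (hq i).2
      (⟨x - (u : SU (i + 1)).1, sub_mem hx (hUV _ (u : SU (i + 1)).2)⟩ : SV (i + 1))
      (Subtype.ext (by
        show W.d (i + 1) (x - (u : SU (i + 1)).1) = 0
        rw [map_sub, hu', sub_self]))
    have hw' : W.d i (w : SV i).1 = x - (u : SU (i + 1)).1 - (z : SU (i + 1)).1 :=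
      congrArg Subtype.val hw
    refine ⟨(w : SV i).1, (w : SV i).2, (u : SU (i + 1)).1 + (z : SU (i + 1)).1,
      add_mem (u : SU (i + 1)).2 (z : SU (i + 1)).2, ?_⟩
    rw [hw']; abel
  let Z : Submodule K (W.V (i + 1)) := SV (i + 1) ⊓ (SU (i + 1 + 1)).comap (W.d (i + 1))
  let φ : (SV i × SU (i + 1)) →ₗ[K] W.V (i + 1) :=
    (W.d i ∘ₗ (SV i).subtype).coprod (SU (i + 1)).subtype
  have hφ : ∀ a, φ a ∈ Z := by
    rintro ⟨⟨v, hv⟩, ⟨w, hw⟩⟩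
    have : φ (⟨v, hv⟩, ⟨w, hw⟩) = W.d i v + w := rfl
    rw [this]
    refine ⟨add_mem (hV _ _ hv) (hUV _ hw), ?_⟩
    show W.d (i + 1) (W.d i v + w) ∈ SU (i + 1 + 1)
    rw [map_add, hW, zero_add]
    exact hU _ _ hw
  let ψ : (SV i × SU (i + 1)) →ₗ[K] Z := φ.codRestrict Z hφ
  have hψ : LinearMap.range ψ = ⊤ := by
    rw [LinearMap.range_eq_top]
    rintro ⟨x, hx⟩
    obtain ⟨v, hv, w, hw, e⟩ := hac x hx.1 hx.2
    exact ⟨(⟨v, hv⟩, ⟨w, hw⟩), Subtype.ext e⟩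
  obtain ⟨σ, hσ⟩ := ψ.exists_rightInverse_of_surjective hψ
  obtain ⟨g0, hg0⟩ := LinearMap.exists_extend (LinearMap.fst K (SV i) (SU (i + 1)) ∘ₗ σ)
  obtain ⟨r, hr⟩ := LinearMap.exists_extend (LinearMap.id : SU (i + 1) →ₗ[K] SU (i + 1))
  have hr' : ∀ x (hx : x ∈ SU (i + 1)), r x = ⟨x, hx⟩ := fun x hx =>
    LinearMap.congr_fun hr ⟨x, hx⟩
  have hg0' : ∀ x (hx : x ∈ Z), x - W.d i (g0 x : W.V i) ∈ SU (i + 1) := by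
    intro x hx
    have h1 : g0 x = (σ ⟨x, hx⟩).1 := LinearMap.congr_fun hg0 ⟨x, hx⟩
    have h2 : W.d i ((σ ⟨x, hx⟩).1 : W.V i) + ((σ ⟨x, hx⟩).2 : W.V (i + 1)) = x :=
      congrArg Subtype.val (LinearMap.congr_fun hσ ⟨x, hx⟩)
    rw [h1]
    have h3 : x - W.d i ((σ ⟨x, hx⟩).1 : W.V i) = ((σ ⟨x, hx⟩).2 : W.V (i + 1)) := by
      rw [sub_eq_iff_eq_add]; exact h2.symm.trans (add_comm _ _)
    rw [h3]
    exact (σ ⟨x, hx⟩).2.2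
  refine ⟨(SV i).subtype ∘ₗ g0 ∘ₗ (LinearMap.id - (SU (i + 1)).subtype ∘ₗ r), ?_, ?_, ?_⟩
  · intro x; exact (g0 _).2
  · intro x hx
    have : g0 (x - (r x : W.V (i + 1))) = 0 := by rw [hr' x hx]; simp
    show ((g0 (x - (r x : W.V (i + 1))) : SV i) : W.V i) = 0
    rw [this]; rfl
  · intro x hx hdx
    show x - W.d i ((g0 (x - (r x : W.V (i + 1))) : SV i) : W.V i) ∈ _
    have hz : x - (r x : W.V (i + 1)) ∈ Z := by
      refine ⟨sub_mem hx (hUV _ (r x).2), ?_⟩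
      show W.d (i + 1) (x - (r x : W.V (i + 1))) ∈ SU (i + 1 + 1)
      rw [map_sub]
      exact sub_mem hdx (hU _ _ (r x).2)
    have := add_mem (hg0' _ hz) (r x).2
    convert this using 1
    abel

lemma exists_h (W : Cx K) (hW : W.IsComplex)
    (SU SV : ∀ i, Submodule K (W.V i))
    (hU : ∀ i, ∀ x ∈ SU i, W.d i x ∈ SU (i + 1))
    (hV : ∀ i, ∀ x ∈ SV i, W.d i x ∈ SV (i + 1))
    (hUV : ∀ i, SU i ≤ SV i)
    (hq : IsQuasiIso (subCx W SU hU) (subCx W SV hV)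
      (fun i => Submodule.inclusion (hUV i))) :
    ∃ h : ∀ i, W.V (i + 1) →ₗ[K] W.V i, (∀ i, ∀ x ∈ SV (i + 1), h i x ∈ SV i) ∧
      (∀ i, ∀ x ∈ SU (i + 1), h i x ∈ SU i) ∧
      ∀ i, ∀ x ∈ SV i, PP W h i x ∈ SU i := by
  choose g hg1 hg2 hg3 using exists_g W hW SU SV hU hV hUV hq
  refine ⟨fun i => g i ∘ₗ (LinearMap.id - g (i + 1) ∘ₗ W.d (i + 1)), ?_, ?_, ?_⟩
  · intro i x _; exact hg1 _ _
  · intro i x hx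
    show g i (x - g (i + 1) (W.d (i + 1) x)) ∈ _
    rw [hg2 (i + 1) _ (hU _ _ hx), sub_zero, hg2 _ _ hx]
    exact zero_mem _
  · intro i x hx
    obtain ⟨i, rfl⟩ : ∃ j, i = j + 1 := ⟨i - 1, by omega⟩
    rw [PP_apply W _ rfl rfl]
    show x - W.d i (g i (x - g (i + 1) (W.d (i + 1) x))) - g (i + 1) (W.d (i + 1) x
      - g (i + 1 + 1) (W.d (i + 1 + 1) (W.d (i + 1) x))) ∈ _
    rw [hW, map_zero, sub_zero, sub_right_comm]
    refine hg3 i _ (sub_mem hx (hg1 _ _)) ?_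
    rw [map_sub]
    refine hg3 (i + 1) _ (hV _ _ hx) ?_
    rw [hW]; exact zero_mem _

/-- Let `U ⊆ V ⊆ W` be subcomplexes of `W` (given by families of submodules
`SU i ≤ SV i` preserved by the differential), and let
`L_{U,V,W} = L_{U,W} ∩ L_{V,W}` be the subcomplex of `Hom*(W, W)` of maps
preserving both `U` and `V`.  If the inclusion `U → V` is a quasi-isomorphism,
then the two inclusions `L_{U,V,W} → L_{V,W}` and `L_{U,V,W} → L_{U,W}` are
quasi-isomorphisms. -/
theorem presCx2_quasiIso (W : Cx K) (hW : W.IsComplex)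
    (SU SV : ∀ i, Submodule K (W.V i))
    (hU : ∀ i, ∀ x ∈ SU i, W.d i x ∈ SU (i + 1))
    (hV : ∀ i, ∀ x ∈ SV i, W.d i x ∈ SV (i + 1))
    (hUV : ∀ i, SU i ≤ SV i)
    (hq : IsQuasiIso (subCx W SU hU) (subCx W SV hV)
      (fun i => Submodule.inclusion (hUV i))) :
    (IsChainMap (presCx2 W SU SV hU hV) (presCx W SV hV)
        (fun n => Submodule.inclusion inf_le_right) ∧
      IsQuasiIso (presCx2 W SU SV hU hV) (presCx W SV hV)
        (fun n => Submodule.inclusion inf_le_right)) ∧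
    (IsChainMap (presCx2 W SU SV hU hV) (presCx W SU hU)
        (fun n => Submodule.inclusion inf_le_left) ∧
      IsQuasiIso (presCx2 W SU SV hU hV) (presCx W SU hU)
        (fun n => Submodule.inclusion inf_le_left)) := by
  obtain ⟨h, hhV, hhU, hP⟩ := exists_h W hW SU SV hU hV hUV hq
  refine ⟨⟨fun i x => rfl, fun n => ⟨?_, ?_⟩⟩, ⟨fun i x => rfl, fun n => ⟨?_, ?_⟩⟩⟩
  · rintro ⟨x, hxU, hxV⟩ hx ⟨⟨w, hw⟩, hwx⟩
    have hx : homD W W (n + 1) x = 0 := congrArg Subtype.val hx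
    have hwx : homD W W n w = x := congrArg Subtype.val hwx
    refine ⟨⟨lP (PP W h) w + lH h x,
      add_mem (fun j z hz => hP _ _ (hw j z (hUV _ hz))) (lH_mem hhU hxU),
      add_mem (fun j z hz => hUV _ (hP _ _ (hw j z hz))) (lH_mem hhV hxV)⟩, Subtype.ext ?_⟩
    show homD W W n (lP (PP W h) w + lH h x) = x
    rw [map_add, homD_lP hW, homD_lH h x hx, hwx]
    abel
  · rintro ⟨y, hyV⟩ hy
    have hy : homD W W (n + 1) y = 0 := congrArg Subtype.val hy
    refine ⟨⟨lP (PP W h) y, fun j z hz => hP _ _ (hyV j z (hUV _ hz)),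
      fun j z hz => hUV _ (hP _ _ (hyV j z hz))⟩, Subtype.ext ?_,
      ⟨lH h y, lH_mem hhV hyV⟩, Subtype.ext ?_⟩
    · show homD W W (n + 1) (lP (PP W h) y) = 0
      rw [homD_lP hW, hy]
      funext j; ext z; exact map_zero (PP W h _)
    · exact homD_lH h y hy
  · rintro ⟨x, hxU, hxV⟩ hx ⟨⟨w, hw⟩, hwx⟩
    have hx : homD W W (n + 1) x = 0 := congrArg Subtype.val hx
    have hwx : homD W W n w = x := congrArg Subtype.val hwx
    refine ⟨⟨rP (PP W h) w + ((-1 : K) ^ (n + 1)) • rH h x,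
      add_mem (fun j z hz => hw j _ (hP _ _ (hUV _ hz)))
        (Submodule.smul_mem _ _ (rH_mem hhU hxU)),
      add_mem (fun j z hz => hUV _ (hw j _ (hP _ _ hz)))
        (Submodule.smul_mem _ _ (rH_mem hhV hxV))⟩, Subtype.ext ?_⟩
    show homD W W n (rP (PP W h) w + ((-1 : K) ^ (n + 1)) • rH h x) = x
    rw [map_add, homD_rP hW, homD_rH h x hx, hwx]
    abel
  · rintro ⟨y, hyU⟩ hy
    have hy : homD W W (n + 1) y = 0 := congrArg Subtype.val hy
    refine ⟨⟨rP (PP W h) y, fun j z hz => hyU j _ (hP _ _ (hUV _ hz)),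
      fun j z hz => hUV _ (hyU j _ (hP _ _ hz))⟩, Subtype.ext ?_,
      ⟨((-1 : K) ^ (n + 1)) • rH h y, Submodule.smul_mem _ _ (rH_mem hhU hyU)⟩, Subtype.ext ?_⟩
    · show homD W W (n + 1) (rP (PP W h) y) = 0
      rw [homD_rP hW, hy]
      rfl
    · exact homD_rH h y hy
end
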